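/- Let n ≥ 2 be an integer, r_n = √(2(n−1)), and 0 < ε₀ < r_n < R₀. Let f : [ε₀, R₀] → ℝ be twice continuously differentiable, positive on [ε₀, R₀], satisfying f''(r)/(1 + f'(r)²) = (r/2 − (n−1)/r) f'(r) − f(r)/2 on [ε₀, R₀], and suppose ∫_{ε₀}^{R₀} f(r)(1 + (n−1)/r²) dr ≤ π. Then f(r) ≤ max(f(ε₀), 2π/(r_n − ε₀)) for every r ∈ [ε₀, r_n]. -/

import Mathlib

open Real MeasureTheory

/-- A function that starts negative, and whose derivative is negative wherever it vanishes for the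
first time, stays negative. -/
lemma neg_of_deriv_neg_at_first_zero {h : ℝ → ℝ} {s t : ℝ} (hcont : ContinuousOn h (Set.Icc s t))
    (hs : h s < 0)
    (hd : ∀ c ∈ Set.Ioc s t, h c = 0 → (∀ x ∈ Set.Ico s c, h x < 0) →
      ∃ d < 0, HasDerivAt h d c) :
    ∀ x ∈ Set.Icc s t, h x < 0 := by
  intro x hx
  by_contra! hx0
  have hne : (Set.Icc s t ∩ h ⁻¹' Set.Ici 0).Nonempty := ⟨x, hx, hx0⟩
  have hcomp : IsCompact (Set.Icc s t ∩ h ⁻¹' Set.Ici 0) :=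
    isCompact_Icc.of_isClosed_subset (hcont.preimage_isClosed_of_isClosed isClosed_Icc isClosed_Ici)
      Set.inter_subset_left
  obtain ⟨c, ⟨hc, hc0⟩, hleast⟩ := hcomp.exists_isLeast hne
  have hc0 : 0 ≤ h c := hc0
  have hneg : ∀ y ∈ Set.Ico s c, h y < 0 := fun y hy => by
    by_contra! hy0
    exact absurd (hleast ⟨⟨hy.1, hy.2.le.trans hc.2⟩, hy0⟩) (not_le.2 hy.2)
  obtain ⟨c', hc', hc'0⟩ := intermediate_value_Icc hc.1
    (hcont.mono (Set.Icc_subset_Icc_right hc.2)) ⟨hs.le, hc0⟩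
  have hcc : c' = c := le_antisymm hc'.2 (hleast ⟨⟨hc'.1, hc'.2.trans hc.2⟩, hc'0.ge⟩)
  subst hcc
  have hsc : s < c' := lt_of_le_of_ne hc.1 (by rintro rfl; linarith)
  obtain ⟨d, hd0, hder⟩ := hd c' ⟨hsc, hc.2⟩ hc'0 hneg
  have hslope := (hasDerivAt_iff_tendsto_slope.1 hder).eventually_lt_const hd0
  have hleft := hslope.filter_mono (nhdsLT_le_nhdsNE c')
  obtain ⟨y, hy, hys⟩ := (hleft.and (Ioo_mem_nhdsLT hsc)).exists
  have hy0 := hneg y ⟨hys.1.le, hys.2⟩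
  rw [slope_def_field, hc'0, sub_zero] at hy
  exact absurd hy (not_lt.2 (div_nonneg_of_nonpos hy0.le (by linarith [hys.2])))

/-- The trapezoid rule underestimates the integral of a concave function. -/
lemma ConcaveOn.trapezoid_le_integral {f : ℝ → ℝ} {s t : ℝ} (hst : s ≤ t)
    (hconc : ConcaveOn ℝ (Set.Icc s t) f) (hcont : ContinuousOn f (Set.Icc s t)) :
    (t - s) * ((f s + f t) / 2) ≤ ∫ r in s..t, f r := by
  rcases hst.eq_or_lt with rfl | hlt
  · simp
  have hts : t - s ≠ 0 := by linarith
  have hline : ∫ r in s..t, (f s + (f t - f s) / (t - s) * (r - s)) =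
      (t - s) * ((f s + f t) / 2) := by
    rw [intervalIntegral.integral_add (by simp)
      ((by fun_prop : Continuous _).intervalIntegrable _ _),
      intervalIntegral.integral_const_mul, intervalIntegral.integral_sub
      ((by fun_prop : Continuous _).intervalIntegrable _ _) (by simp)]
    simp only [intervalIntegral.integral_const, integral_id, smul_eq_mul]
    field_simp
    ring
  rw [← hline]
  refine intervalIntegral.integral_mono_on hst
    ((by fun_prop : Continuous _).intervalIntegrable _ _)
    (hcont.intervalIntegrable_of_Icc hst) fun r hr => ?_
  have key := hconc.2 (Set.left_mem_Icc.2 hst) (Set.right_mem_Icc.2 hst)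
    (div_nonneg (sub_nonneg.2 hr.2) (sub_nonneg.2 hst))
    (div_nonneg (sub_nonneg.2 hr.1) (sub_nonneg.2 hst)) (by field_simp; ring)
  simp only [smul_eq_mul] at key
  have e : (t - r) / (t - s) * s + (r - s) / (t - s) * t = r := by field_simp; ring
  rw [e] at key
  refine le_trans (le_of_eq ?_) key
  field_simp
  ring

/-- The integral of a nonnegative concave function is at least the area of the triangle spanned
by the interval and a point of the graph. -/
lemma ConcaveOn.triangle_le_integral {f : ℝ → ℝ} {a b m : ℝ} (hm : m ∈ Set.Icc a b)
    (hconc : ConcaveOn ℝ (Set.Icc a b) f) (hcont : ContinuousOn f (Set.Icc a b))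
    (ha : 0 ≤ f a) (hb : 0 ≤ f b) :
    (b - a) * (f m / 2) ≤ ∫ r in a..b, f r := by
  have hsub₁ : Set.Icc a m ⊆ Set.Icc a b := Set.Icc_subset_Icc_right hm.2
  have hsub₂ : Set.Icc m b ⊆ Set.Icc a b := Set.Icc_subset_Icc_left hm.1
  have h₁ := (hconc.subset hsub₁ (convex_Icc _ _)).trapezoid_le_integral hm.1 (hcont.mono hsub₁)
  have h₂ := (hconc.subset hsub₂ (convex_Icc _ _)).trapezoid_le_integral hm.2 (hcont.mono hsub₂)
  rw [← intervalIntegral.integral_add_adjacent_intervals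
    ((hcont.mono hsub₁).intervalIntegrable_of_Icc hm.1)
    ((hcont.mono hsub₂).intervalIntegrable_of_Icc hm.2)]
  nlinarith [mul_nonneg (sub_nonneg.2 hm.1) ha, mul_nonneg (sub_nonneg.2 hm.2) hb]

/-- Writing `k = n - 1`: a positive solution of the geodesic equation whose maximum over `[a, √(2k)]`
is not attained at `a` has negative right-hand side of the equation throughout `(a, √(2k))`. -/
lemma geodesic_rhs_neg {f : ℝ → ℝ} {a R k m : ℝ} (hk : 0 < k) (ha : 0 < a)
    (hR : √(2 * k) < R) (hf : ContDiffOn ℝ 2 f (Set.Ioo a R))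
    (hfpos : ∀ r ∈ Set.Ioo a R, 0 < f r)
    (heq : ∀ r ∈ Set.Ioo a R,
      deriv (deriv f) r / (1 + (deriv f r) ^ 2) = (r / 2 - k / r) * deriv f r - f r / 2)
    (hm : m ∈ Set.Ioc a (√(2 * k))) (hmax : IsMaxOn f (Set.Icc a (√(2 * k))) m) :
    ∀ r ∈ Set.Ioo a (√(2 * k)), (r / 2 - k / r) * deriv f r - f r / 2 < 0 := by
  have hp : ContDiffOn ℝ 1 (deriv f) (Set.Ioo a R) :=
    ((contDiffOn_succ_iff_deriv_of_isOpen (n := 1) isOpen_Ioo).1 hf).2.2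
  have hdf : ∀ r ∈ Set.Ioo a R, HasDerivAt f (deriv f r) r := fun r hr =>
    ((hf.differentiableOn (by norm_num)).differentiableAt (isOpen_Ioo.mem_nhds hr)).hasDerivAt
  have hdp : ∀ r ∈ Set.Ioo a R, HasDerivAt (deriv f)
      ((1 + (deriv f r) ^ 2) * ((r / 2 - k / r) * deriv f r - f r / 2)) r := fun r hr => by
    have h := ((hp.differentiableOn (by norm_num)).differentiableAt
      (isOpen_Ioo.mem_nhds hr)).hasDerivAt
    rwa [← heq r hr, mul_div_cancel₀ _ (by positivity)]
  have hcoef : ∀ r, a < r → r ≤ √(2 * k) → r / 2 - k / r ≤ 0 := fun r hr hrb => by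
    have hr0 : 0 < r := ha.trans hr
    have h2 : r ^ 2 ≤ 2 * k := (Real.le_sqrt hr0.le (by positivity)).1 hrb
    rw [sub_nonpos, div_le_div_iff₀ two_pos hr0]
    nlinarith
  have hneg_of_nonneg : ∀ r, a < r → r ≤ √(2 * k) → 0 ≤ deriv f r →
      (r / 2 - k / r) * deriv f r - f r / 2 < 0 := fun r hr hrb hd => by
    have := hfpos r ⟨hr, hrb.trans_lt hR⟩
    have := mul_nonpos_of_nonpos_of_nonneg (hcoef r hr hrb) hd
    linarith
  have hmR : m ∈ Set.Ioo a R := ⟨hm.1, hm.2.trans_lt hR⟩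
  have hpm : 0 ≤ deriv f m := by
    have hslope := (hasDerivAt_iff_tendsto_slope.1 (hdf m hmR)).mono_left
      (nhdsLT_le_nhdsNE m)
    refine ge_of_tendsto hslope ?_
    filter_upwards [Ioo_mem_nhdsLT hm.1] with y hy
    rw [slope_def_field]
    have : f y ≤ f m := hmax ⟨hy.1.le, hy.2.le.trans hm.2⟩
    exact div_nonneg_of_nonpos (by linarith) (by linarith [hy.2])
  intro r hr
  rcases le_or_gt r m with hrm | hrm
  · refine hneg_of_nonneg r hr.1 hr.2.le ?_
    by_contra! hlt
    refine absurd (neg_of_deriv_neg_at_first_zero (h := deriv f) (s := r) (t := m)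
      (hp.continuousOn.mono fun y hy => ⟨hr.1.trans_le hy.1, hy.2.trans_lt hmR.2⟩) hlt
      (fun c hc hc0 _ => ?_) m ⟨hrm, le_rfl⟩) (not_lt.2 hpm)
    have hac := hr.1.trans hc.1
    refine ⟨_, ?_, hdp c ⟨hac, hc.2.trans_lt hmR.2⟩⟩
    exact mul_neg_of_pos_of_neg (by positivity)
      (hneg_of_nonneg c hac (hc.2.trans hm.2) hc0.ge)
  · have hmb : m < √(2 * k) := hrm.trans hr.2
    have hp0 : deriv f m = 0 := (hmax.isLocalMax (Icc_mem_nhds hm.1 hmb)).deriv_eq_zero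
    have hdG : ∀ x ∈ Set.Ioo a R, HasDerivAt
        (fun r => (r / 2 - k / r) * deriv f r - f r / 2)
        ((1 / 2 + k / x ^ 2) * deriv f x + (x / 2 - k / x) *
          ((1 + (deriv f x) ^ 2) * ((x / 2 - k / x) * deriv f x - f x / 2)) - deriv f x / 2)
        x := fun x hx => by
      have hx0 : x ≠ 0 := (ha.trans hx.1).ne'
      have hc : HasDerivAt (fun r : ℝ => r / 2 - k / r) (1 / 2 + k / x ^ 2) x := by
        refine (((hasDerivAt_id' x).div_const 2).sub
          ((hasDerivAt_const x k).div (hasDerivAt_id' x) hx0)).congr_deriv ?_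
        ring
      exact (hc.mul (hdp x hx)).sub ((hdf x hx).div_const 2)
    have hmem : ∀ y ∈ Set.Icc m r, y ∈ Set.Ioo a R := fun y hy =>
      ⟨hm.1.trans_le hy.1, hy.2.trans_lt (hr.2.trans hR)⟩
    refine neg_of_deriv_neg_at_first_zero
      (h := fun r => (r / 2 - k / r) * deriv f r - f r / 2) (s := m) (t := r)
      (fun y hy => (hdG y (hmem y hy)).continuousAt.continuousWithinAt)
      (hneg_of_nonneg m hm.1 hm.2 hpm) (fun c hc hc0 hneg => ?_) r ⟨hrm.le, le_rfl⟩
    have hcR := hmem c ⟨hc.1.le, hc.2⟩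
    refine ⟨_, ?_, hdG c hcR⟩
    have hanti : StrictAntiOn (deriv f) (Set.Icc m c) := by
      refine strictAntiOn_of_deriv_neg (convex_Icc _ _)
        (hp.continuousOn.mono fun y hy => hmem y ⟨hy.1, hy.2.trans hc.2⟩) fun y hy => ?_
      rw [interior_Icc] at hy
      rw [(hdp y (hmem y ⟨hy.1.le, hy.2.le.trans hc.2⟩)).deriv]
      exact mul_neg_of_pos_of_neg (by positivity) (hneg y ⟨hy.1.le, hy.2⟩)
    have hpc : deriv f c < 0 := by
      rw [← hp0]
      exact hanti (Set.left_mem_Icc.2 hc.1.le) (Set.right_mem_Icc.2 hc.1.le) hc.1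
    have hc0 : (c / 2 - k / c) * deriv f c - f c / 2 = 0 := hc0
    rw [hc0]
    have hkc : 0 < k / c ^ 2 := div_pos hk (pow_pos (ha.trans hcR.1) 2)
    nlinarith [mul_neg_of_pos_of_neg hkc hpc]

/-- **Lemma 5.6, left side:** a positive graphical geodesic on `[ε₀, R₀]` with
`ε₀ < r_n < R₀` whose graph bounds Gauss area at most `π` satisfies
`f ≤ max (f(ε₀), 2π/(r_n - ε₀))` on `[ε₀, r_n]`. -/
theorem geodesic_bounded_left (n : ℕ) (hn : 2 ≤ n) (ε₀ R₀ : ℝ)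
    (hε₀ : 0 < ε₀) (hlt : ε₀ < Real.sqrt (2 * ((n : ℝ) - 1)))
    (hgt : Real.sqrt (2 * ((n : ℝ) - 1)) < R₀)
    (f : ℝ → ℝ) (hf : ContDiffOn ℝ 2 f (Set.Icc ε₀ R₀))
    (hfpos : ∀ r ∈ Set.Icc ε₀ R₀, 0 < f r)
    (heq : ∀ r ∈ Set.Icc ε₀ R₀,
      deriv (deriv f) r / (1 + (deriv f r) ^ 2) =
        (r / 2 - ((n : ℝ) - 1) / r) * deriv f r - f r / 2)
    (harea : (∫ r in ε₀..R₀, f r * (1 + ((n : ℝ) - 1) / r ^ 2)) ≤ π) :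
    ∀ r ∈ Set.Icc ε₀ (Real.sqrt (2 * ((n : ℝ) - 1))),
      f r ≤ max (f ε₀) (2 * π / (Real.sqrt (2 * ((n : ℝ) - 1)) - ε₀)) := by
  intro r hr
  by_contra! hlarge
  obtain ⟨hfa, hfarea⟩ := max_lt_iff.1 hlarge
  have hk : 0 < (n : ℝ) - 1 := by
    have : (2 : ℝ) ≤ n := by exact_mod_cast hn
    linarith
  generalize (n : ℝ) - 1 = k at *
  have hsub : Set.Icc ε₀ (√(2 * k)) ⊆ Set.Icc ε₀ R₀ := Set.Icc_subset_Icc_right hgt.le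
  have hcont := hf.continuousOn.mono hsub
  obtain ⟨m, hm, hmax⟩ := isCompact_Icc.exists_isMaxOn (Set.nonempty_Icc.2 hlt.le) hcont
  have hrm : f r ≤ f m := hmax hr
  have ham : ε₀ < m := lt_of_le_of_ne hm.1 (by rintro rfl; linarith)
  have hneg := geodesic_rhs_neg hk hε₀ hgt (hf.mono Set.Ioo_subset_Icc_self)
    (fun x hx => hfpos x (Set.Ioo_subset_Icc_self hx))
    (fun x hx => heq x (Set.Ioo_subset_Icc_self hx)) ⟨ham, hm.2⟩ hmax
  have hopen := (contDiffOn_succ_iff_deriv_of_isOpen (n := 1) isOpen_Ioo).1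
    (hf.mono (Set.Ioo_subset_Icc_self.trans hsub))
  have hconc : ConcaveOn ℝ (Set.Icc ε₀ (√(2 * k))) f := by
    refine concaveOn_of_deriv2_nonpos (convex_Icc _ _) hcont ?_ ?_ fun x hx => ?_
    · rw [interior_Icc]
      exact hopen.1
    · rw [interior_Icc]
      exact hopen.2.2.differentiableOn (by norm_num)
    · rw [interior_Icc] at hx
      have h := (hneg x hx).le
      rwa [← heq x (hsub (Set.Ioo_subset_Icc_self hx)), div_le_iff₀ (by positivity), zero_mul] at h
  have htri := hconc.triangle_le_integral hm hcont
    (hfpos _ (Set.left_mem_Icc.2 (hlt.trans hgt).le)).le (hfpos _ ⟨hlt.le, hgt.le⟩).le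
  have hcontw : ContinuousOn (fun r => f r * (1 + k / r ^ 2)) (Set.Icc ε₀ R₀) :=
    hf.continuousOn.mul (continuousOn_const.add (continuousOn_const.div (by fun_prop)
      fun x hx => (pow_pos (hε₀.trans_le hx.1) 2).ne'))
  have hweight : ∫ r in ε₀..√(2 * k), f r ≤ ∫ r in ε₀..√(2 * k), f r * (1 + k / r ^ 2) :=
    intervalIntegral.integral_mono_on hlt.le (hcont.intervalIntegrable_of_Icc hlt.le)
      ((hcontw.mono hsub).intervalIntegrable_of_Icc hlt.le) fun x hx =>
        le_mul_of_one_le_right (hfpos x (hsub hx)).le (le_add_of_nonneg_right (by positivity))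
  have htail : 0 ≤ ∫ r in √(2 * k)..R₀, f r * (1 + k / r ^ 2) :=
    intervalIntegral.integral_nonneg hgt.le fun x hx =>
      mul_nonneg (hfpos x ⟨hlt.le.trans hx.1, hx.2⟩).le (by positivity)
  rw [← intervalIntegral.integral_add_adjacent_intervals
    ((hcontw.mono hsub).intervalIntegrable_of_Icc hlt.le)
    ((hcontw.mono (Set.Icc_subset_Icc_left hlt.le)).intervalIntegrable_of_Icc hgt.le)] at harea
  rw [div_lt_iff₀ (sub_pos.2 hlt)] at hfarea
  nlinarith [mul_le_mul_of_nonneg_right hrm (sub_pos.2 hlt).le]
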